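/- In the golf model on Z/nZ with parameters n, n_b, n_t, p, assume K := n_t − n_b > 0. Then for every subset X ⊆ Z/nZ with |X| = K, writing ℓ_i = Δ_i X for i ∈ Z/KZ, one has P(TL = X) = (1 / multinom(n; n_b, n_t, n−n_b−n_t)) · Σ_{(b_i)} Π_{i∈Z/KZ} (1/(b_i+1)) · multinom(ℓ_i; b_i, b_i, ℓ_i−2b_i), where the sum ranges over all families (b_i)_{i∈Z/KZ} of nonnegative integers with Σ_i b_i = n_b and 2b_i ≤ ℓ_i for every i, and multinom(N; a, b, c) = N!/(a!·b!·c!) is the multinomial coefficient. In particular, this probability does not depend on p ∈ (0,1). -/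

import Mathlib

open Finset MeasureTheory Filter Asymptotics
open scoped Classical

namespace Golf

/-- Canonical position of a vertex of the cycle `Z/nZ` in `{1, …, n}`. -/
def cpos {n : ℕ} (v : Fin n) : ℕ := if v.val = 0 then n else v.val

/-- Shift a vertex by `d` steps in the positive direction. -/
def shiftR {n : ℕ} (v : Fin n) (d : ℕ) : Fin n :=
  ⟨(v.val + d) % n, Nat.mod_lt _ (Nat.lt_of_le_of_lt (Nat.zero_le _) v.isLt)⟩

/-- Shift a vertex by `d` steps in the negative direction. -/
def shiftL {n : ℕ} (v : Fin n) (d : ℕ) : Fin n := shiftR v (n - d % n)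

/-- Distance (in `[1, n]`) from `v` to the nearest element of `H` in the positive direction. -/
def distR {n : ℕ} (H : Finset (Fin n)) (v : Fin n) : ℕ :=
  if h : ((Finset.Icc 1 n).filter fun d => shiftR v d ∈ H).Nonempty then
    ((Finset.Icc 1 n).filter fun d => shiftR v d ∈ H).min' h
  else 0

/-- Distance (in `[1, n]`) from `v` to the nearest element of `H` in the negative direction. -/
def distL {n : ℕ} (H : Finset (Fin n)) (v : Fin n) : ℕ :=
  if h : ((Finset.Icc 1 n).filter fun d => shiftL v d ∈ H).Nonempty then
    ((Finset.Icc 1 n).filter fun d => shiftL v d ∈ H).min' h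
  else 0

/-- Probability that the ball activated at `v` fills the nearest free hole in the positive
direction, when the current set of free holes is `H`, for the `p`-biased random walk. -/
noncomputable def rightProb {n : ℕ} (p : ℝ) (H : Finset (Fin n)) (v : Fin n) : ℝ :=
  if p = 1 / 2 then (distL H v : ℝ) / ((distL H v : ℝ) + (distR H v : ℝ))
  else (1 - ((1 - p) / p) ^ distL H v) / (1 - ((1 - p) / p) ^ (distL H v + distR H v))

/-- New set of free holes after the ball at `v` makes its choice
(`true` = fill the nearest free hole in the positive direction). -/
def golfStep {n : ℕ} (H : Finset (Fin n)) (v : Fin n) (choice : Bool) : Finset (Fin n) :=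
  if choice then H.erase (shiftR v (distR H v)) else H.erase (shiftL v (distL H v))

/-- Final set of free holes after activating the listed balls with the listed choices. -/
def golfRun {n : ℕ} : List (Fin n) → List Bool → Finset (Fin n) → Finset (Fin n)
  | v :: vs, c :: cs, H => golfRun vs cs (golfStep H v c)
  | _, _, H => H

/-- Probability of a given sequence of left/right choices. -/
noncomputable def golfWeight {n : ℕ} (p : ℝ) :
    List (Fin n) → List Bool → Finset (Fin n) → ℝ
  | v :: vs, c :: cs, H =>
      (if c then rightProb p H v else 1 - rightProb p H v) * golfWeight p vs cs (golfStep H v c)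
  | _, _, _ => 1

/-- Initial data of the golf model: an initial configuration with `nb` balls (listed in their
activation order, encoded as an embedding `Fin nb ↪ Fin n`) and `nt` holes, the balls and holes
being on distinct vertices.  The initial configuration together with the activation order is
uniform on this set. -/
noncomputable def golfInit (n nb nt : ℕ) : Finset ((Fin nb ↪ Fin n) × Finset (Fin n)) :=
  Finset.univ.filter fun fT => fT.2.card = nt ∧ ∀ i, fT.1 i ∉ fT.2

/-- Expectation of `g B⁰ T⁰ TL` in the golf model on `Z/nZ` with `nb` balls, `nt` holes and
walk parameter `p`, where `B⁰` is the initial set of balls, `T⁰` the initial set of holes and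
`TL` the final set of free holes. -/
noncomputable def golfExp (n nb nt : ℕ) (p : ℝ)
    (g : Finset (Fin n) → Finset (Fin n) → Finset (Fin n) → ℝ) : ℝ :=
  (∑ fT ∈ golfInit n nb nt, ∑ cs : Fin nb → Bool,
      golfWeight p (List.ofFn ⇑fT.1) (List.ofFn cs) fT.2 *
        g (Finset.univ.map fT.1) fT.2 (golfRun (List.ofFn ⇑fT.1) (List.ofFn cs) fT.2)) /
    (golfInit n nb nt).card

/-- `golfProb n nb nt p X` is the probability that the final set of free holes is `X`. -/
noncomputable def golfProb (n nb nt : ℕ) (p : ℝ) (X : Finset (Fin n)) : ℝ :=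
  golfExp n nb nt p fun _ _ TL => if TL = X then 1 else 0

/-- Sorted list of the canonical positions of the elements of `X`. -/
def sortedPos {n : ℕ} (X : Finset (Fin n)) : List ℕ := (X.image cpos).sort (· ≤ ·)

/-- `blockSize X i` is the size `Δ_i X` of the `i`-th block of `X`. -/
def blockSize {n : ℕ} (X : Finset (Fin n)) (i : ℕ) : ℕ :=
  let q := sortedPos X
  let k := q.length
  (q.getD (i % k) 0 + n - q.getD ((i + k - 1) % k) 0 - 1) % n

/-- `blockSet X i` is the `i`-th block `B_i` of `X`: the set of vertices strictly between
`x_i` and `x_{i+1}` in the positive direction. -/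
def blockSet {n : ℕ} (X : Finset (Fin n)) (i : ℕ) : Finset (Fin n) :=
  let q := sortedPos X
  let k := q.length
  let lo := q.getD ((i + k - 1) % k) 0
  let hi := q.getD (i % k) 0
  Finset.univ.filter fun v =>
    if lo < hi then lo < cpos v ∧ cpos v < hi else cpos v < hi ∨ lo < cpos v

/-- Size of the largest block of `X`. -/
def maxBlockSize {n : ℕ} (X : Finset (Fin n)) : ℕ :=
  (Finset.range X.card).sup (blockSize X)

/-- `multinom3 a b c` is the multinomial coefficient `(a+b+c)! / (a! b! c!)`. -/
def multinom3 (a b c : ℕ) : ℕ :=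
  (a + b + c).factorial / (a.factorial * b.factorial * c.factorial)

end Golf

namespace Golf

section Shift

variable {n : ℕ}

theorem shiftR_shiftR (v : Fin n) (a b : ℕ) : shiftR (shiftR v a) b = shiftR v (a + b) := by
  apply Fin.ext
  simp [shiftR, Nat.mod_add_mod, add_assoc]

theorem shiftR_injective (d : ℕ) : Function.Injective fun v : Fin n => shiftR v d := by
  intro u v h
  have h' : (u.val + d) % n = (v.val + d) % n := congrArg Fin.val h
  have h2 : u.val ≡ v.val [MOD n] := Nat.ModEq.add_right_cancel' d h'
  apply Fin.ext
  have h3 : u.val % n = v.val % n := h2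
  rwa [Nat.mod_eq_of_lt u.isLt, Nat.mod_eq_of_lt v.isLt] at h3

theorem shiftR_left_injective (v : Fin n) {a b : ℕ} (ha : a < n) (hb : b < n)
    (h : shiftR v a = shiftR v b) : a = b := by
  have h' : (v.val + a) % n = (v.val + b) % n := congrArg Fin.val h
  have h2 : a ≡ b [MOD n] := Nat.ModEq.add_left_cancel' v.val h'
  have h3 : a % n = b % n := h2
  rwa [Nat.mod_eq_of_lt ha, Nat.mod_eq_of_lt hb] at h3

theorem shiftR_shiftL_self (v : Fin n) (d : ℕ) : shiftR (shiftL v d) d = v := by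
  have hn : 0 < n := Nat.lt_of_le_of_lt (Nat.zero_le _) v.isLt
  rw [shiftL, shiftR_shiftR]
  apply Fin.ext
  have h1 : n - d % n + d = n + n * (d / n) := by
    have := Nat.mod_add_div d n
    have := Nat.mod_lt d hn
    omega
  simp [shiftR, h1, Nat.mod_eq_of_lt v.isLt, ← add_assoc]

theorem shiftL_shiftR_self (v : Fin n) (d : ℕ) : shiftL (shiftR v d) d = v :=
  shiftR_injective d (shiftR_shiftL_self _ _)

theorem shiftL_eq_iff {v w : Fin n} {d : ℕ} : shiftL v d = w ↔ v = shiftR w d := by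
  constructor
  · rintro rfl
    exact (shiftR_shiftL_self v d).symm
  · rintro rfl
    exact shiftL_shiftR_self w d

theorem shiftL_shiftR (v : Fin n) {a b : ℕ} (h : b ≤ a) :
    shiftL (shiftR v a) b = shiftR v (a - b) := by
  rw [shiftL_eq_iff, shiftR_shiftR, Nat.sub_add_cancel h]

theorem shiftL_shiftR' (v : Fin n) {a b : ℕ} (h : a ≤ b) :
    shiftL (shiftR v a) b = shiftL v (b - a) := by
  rw [shiftL_eq_iff]
  nth_rewrite 1 [← shiftR_shiftL_self v (b - a)]
  rw [shiftR_shiftR, Nat.sub_add_cancel h]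

theorem shiftR_shiftL (v : Fin n) {a b : ℕ} (h : b ≤ a) :
    shiftR (shiftL v a) b = shiftL v (a - b) := by
  symm
  rw [shiftL_eq_iff, shiftR_shiftR, Nat.add_sub_cancel' h, shiftR_shiftL_self]

theorem shiftL_shiftL (v : Fin n) (a b : ℕ) : shiftL (shiftL v a) b = shiftL v (a + b) := by
  rw [shiftL_eq_iff, shiftR_shiftL v (Nat.le_add_left b a), Nat.add_sub_cancel]

theorem shiftR_zero (v : Fin n) : shiftR v 0 = v := by
  apply Fin.ext
  simp [shiftR, Nat.mod_eq_of_lt v.isLt]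

theorem shiftL_zero (v : Fin n) : shiftL v 0 = v := by
  rw [shiftL_eq_iff, shiftR_zero]

theorem exists_shiftR_eq (v w : Fin n) : ∃ d, 1 ≤ d ∧ d ≤ n ∧ shiftR v d = w := by
  have hv := v.isLt
  have hw := w.isLt
  rcases lt_or_ge v.val w.val with h | h
  · refine ⟨w - v, by omega, by omega, Fin.ext ?_⟩
    simp only [shiftR]
    rw [Nat.add_sub_cancel' h.le, Nat.mod_eq_of_lt hw]
  · refine ⟨w + n - v, by omega, by omega, Fin.ext ?_⟩
    simp only [shiftR]
    rw [Nat.add_sub_cancel' (by omega), Nat.add_mod_right, Nat.mod_eq_of_lt hw]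

end Shift

section Distance

variable {n m : ℕ}

theorem distR_eq {H : Finset (Fin n)} {v : Fin n} {d : ℕ} (h1 : 1 ≤ d) (hn : d ≤ n)
    (hd : shiftR v d ∈ H) (hmin : ∀ e, 1 ≤ e → e < d → shiftR v e ∉ H) : distR H v = d := by
  have hmem : d ∈ (Finset.Icc 1 n).filter fun d => shiftR v d ∈ H := by simp [h1, hn, hd]
  rw [distR, dif_pos ⟨d, hmem⟩]
  refine le_antisymm (Finset.min'_le _ _ hmem) (Finset.le_min' _ _ _ fun e he => ?_)
  simp only [Finset.mem_filter, Finset.mem_Icc] at he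
  by_contra hlt
  exact hmin e he.1.1 (not_le.mp hlt) he.2

theorem distL_eq {H : Finset (Fin n)} {v : Fin n} {d : ℕ} (h1 : 1 ≤ d) (hn : d ≤ n)
    (hd : shiftL v d ∈ H) (hmin : ∀ e, 1 ≤ e → e < d → shiftL v e ∉ H) : distL H v = d := by
  have hmem : d ∈ (Finset.Icc 1 n).filter fun d => shiftL v d ∈ H := by simp [h1, hn, hd]
  rw [distL, dif_pos ⟨d, hmem⟩]
  refine le_antisymm (Finset.min'_le _ _ hmem) (Finset.le_min' _ _ _ fun e he => ?_)
  simp only [Finset.mem_filter, Finset.mem_Icc] at he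
  by_contra hlt
  exact hmin e he.1.1 (not_le.mp hlt) he.2

theorem distR_spec {H : Finset (Fin n)} (hH : H.Nonempty) (v : Fin n) :
    1 ≤ distR H v ∧ distR H v ≤ n ∧ shiftR v (distR H v) ∈ H ∧
      ∀ e, 1 ≤ e → e < distR H v → shiftR v e ∉ H := by
  obtain ⟨w, hw⟩ := hH
  obtain ⟨d, h1, h2, rfl⟩ := exists_shiftR_eq v w
  have hne : ((Finset.Icc 1 n).filter fun d => shiftR v d ∈ H).Nonempty :=
    ⟨d, by simp [h1, h2, hw]⟩
  rw [distR, dif_pos hne]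
  have hm := Finset.min'_mem _ hne
  simp only [Finset.mem_filter, Finset.mem_Icc] at hm
  refine ⟨hm.1.1, hm.1.2, hm.2, fun e he hlt hmem => ?_⟩
  have := Finset.min'_le ((Finset.Icc 1 n).filter fun d => shiftR v d ∈ H) e (by
    simp only [Finset.mem_filter, Finset.mem_Icc]
    exact ⟨⟨he, by omega⟩, hmem⟩)
  omega

theorem distL_spec {H : Finset (Fin n)} (hH : H.Nonempty) (v : Fin n) :
    1 ≤ distL H v ∧ distL H v ≤ n ∧ shiftL v (distL H v) ∈ H ∧
      ∀ e, 1 ≤ e → e < distL H v → shiftL v e ∉ H := by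
  obtain ⟨w, hw⟩ := hH
  obtain ⟨d, h1, h2, h3⟩ := exists_shiftR_eq w v
  obtain rfl := shiftL_eq_iff.mpr h3.symm
  have hne : ((Finset.Icc 1 n).filter fun d => shiftL v d ∈ H).Nonempty :=
    ⟨d, by simp [h1, h2, hw]⟩
  rw [distL, dif_pos hne]
  have hm := Finset.min'_mem _ hne
  simp only [Finset.mem_filter, Finset.mem_Icc] at hm
  refine ⟨hm.1.1, hm.1.2, hm.2, fun e he hlt hmem => ?_⟩
  have := Finset.min'_le ((Finset.Icc 1 n).filter fun d => shiftL v d ∈ H) e (by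
    simp only [Finset.mem_filter, Finset.mem_Icc]
    exact ⟨⟨he, by omega⟩, hmem⟩)
  omega

theorem distR_le {H : Finset (Fin n)} {v : Fin n} {c : ℕ} (hc : 1 ≤ c) (h : shiftR v c ∈ H) :
    distR H v ≤ c := by
  by_contra hlt
  exact (distR_spec ⟨_, h⟩ v).2.2.2 c hc (not_le.mp hlt) h

theorem distL_le {H : Finset (Fin n)} {v : Fin n} {c : ℕ} (hc : 1 ≤ c) (h : shiftL v c ∈ H) :
    distL H v ≤ c := by
  by_contra hlt
  exact (distL_spec ⟨_, h⟩ v).2.2.2 c hc (not_le.mp hlt) h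

/-- Two clockwise distances agree as soon as the two hole sets, seen from the two starting
points, agree up to some common hole. -/
theorem distR_congr {H : Finset (Fin n)} {H' : Finset (Fin m)} {v : Fin n} {v' : Fin m} {c : ℕ}
    (hc : 1 ≤ c) (hm : c ≤ m) (hcH : shiftR v c ∈ H)
    (h : ∀ d, 1 ≤ d → d ≤ c → (shiftR v d ∈ H ↔ shiftR v' d ∈ H')) :
    distR H v = distR H' v' := by
  obtain ⟨h1, -, h3, h4⟩ := distR_spec ⟨_, hcH⟩ v
  have hle := distR_le hc hcH
  refine (distR_eq h1 (hle.trans hm) ((h _ h1 hle).mp h3) fun e he hlt hmem => ?_).symm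
  exact h4 e he hlt ((h e he (hlt.le.trans hle)).mpr hmem)

theorem distL_congr {H : Finset (Fin n)} {H' : Finset (Fin m)} {v : Fin n} {v' : Fin m} {c : ℕ}
    (hc : 1 ≤ c) (hm : c ≤ m) (hcH : shiftL v c ∈ H)
    (h : ∀ d, 1 ≤ d → d ≤ c → (shiftL v d ∈ H ↔ shiftL v' d ∈ H')) :
    distL H v = distL H' v' := by
  obtain ⟨h1, -, h3, h4⟩ := distL_spec ⟨_, hcH⟩ v
  have hle := distL_le hc hcH
  refine (distL_eq h1 (hle.trans hm) ((h _ h1 hle).mp h3) fun e he hlt hmem => ?_).symm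
  exact h4 e he hlt ((h e he (hlt.le.trans hle)).mpr hmem)

end Distance

section Block

variable {n : ℕ}

/-- The nearest element of `X` strictly before `v`. -/
def blockStart (X : Finset (Fin n)) (v : Fin n) : Fin n := shiftL v (distL X v)

theorem blockStart_mem {X : Finset (Fin n)} (hX : X.Nonempty) (v : Fin n) :
    blockStart X v ∈ X :=
  (distL_spec hX v).2.2.1

theorem blockStart_shiftR {X : Finset (Fin n)} (hX : X.Nonempty) {v : Fin n} {d : ℕ}
    (hd : d < distR X v) (hv : v ∉ X) : blockStart X (shiftR v d) = blockStart X v := by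
  obtain ⟨l1, l2, l3, l4⟩ := distL_spec hX v
  obtain ⟨r1, r2, r3, r4⟩ := distR_spec hX v
  have key : distL X (shiftR v d) = d + distL X v := by
    have hmem : shiftL (shiftR v d) (d + distL X v) ∈ X := by
      rw [shiftL_shiftR' v (by omega), Nat.add_sub_cancel_left]
      exact l3
    have hmin : ∀ e, 1 ≤ e → e < d + distL X v → shiftL (shiftR v d) e ∉ X := by
      intro e he hlt
      rcases lt_trichotomy e d with h | h | h
      · rw [shiftL_shiftR v h.le]
        exact r4 _ (by omega) (by omega)
      · rw [h, shiftL_shiftR_self]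
        exact hv
      · rw [shiftL_shiftR' v h.le]
        exact l4 _ (by omega) (by omega)
    refine distL_eq (by omega) ?_ hmem hmin
    by_contra hlt
    obtain ⟨s1, s2, s3, -⟩ := distL_spec hX (shiftR v d)
    exact hmin _ s1 (by omega) s3
  rw [blockStart, key, shiftL_shiftR' v (by omega), Nat.add_sub_cancel_left, blockStart]

theorem blockStart_shiftL {X : Finset (Fin n)} (hX : X.Nonempty) {v : Fin n} {d : ℕ}
    (hd : d < distL X v) : blockStart X (shiftL v d) = blockStart X v := by
  obtain ⟨l1, l2, l3, l4⟩ := distL_spec hX v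
  have key : distL X (shiftL v d) = distL X v - d := by
    refine distL_eq (by omega) (by omega) ?_ fun e he hlt => ?_
    · rw [shiftL_shiftL, Nat.add_sub_cancel' hd.le]
      exact l3
    · rw [shiftL_shiftL]
      exact l4 _ (by omega) (by omega)
  rw [blockStart, key, shiftL_shiftL, Nat.add_sub_cancel' hd.le, blockStart]

theorem blockStart_shiftR_of_mem {X : Finset (Fin n)} {x : Fin n} (hx : x ∈ X) {j : ℕ}
    (h0 : 0 < j) (hj : j < distR X x) : blockStart X (shiftR x j) = x := by
  obtain ⟨r1, r2, r3, r4⟩ := distR_spec ⟨x, hx⟩ x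
  have key : distL X (shiftR x j) = j := by
    refine distL_eq h0 (by omega) ?_ fun e he hlt => ?_
    · rwa [shiftL_shiftR_self]
    · rw [shiftL_shiftR x hlt.le]
      exact r4 _ (by omega) (by omega)
  rw [blockStart, key, shiftL_shiftR_self]

theorem exists_shiftR_blockStart {X : Finset (Fin n)} (hX : X.Nonempty) {v : Fin n}
    (hv : v ∉ X) :
    ∃ j, 0 < j ∧ j < distR X (blockStart X v) ∧ shiftR (blockStart X v) j = v := by
  obtain ⟨l1, l2, l3, l4⟩ := distL_spec hX v
  refine ⟨distL X v, l1, ?_, shiftR_shiftL_self v _⟩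
  by_contra hlt
  obtain ⟨r1, r2, r3, r4⟩ := distR_spec hX (blockStart X v)
  rw [blockStart, shiftR_shiftL v (by rw [blockStart] at hlt; omega)] at r3
  rw [blockStart] at r1 hlt
  rcases Nat.eq_zero_or_pos (distL X v - distR X (shiftL v (distL X v))) with h | h
  · rw [h, shiftL_zero] at r3
    exact hv r3
  · exact l4 _ h (by omega) r3

end Block

section FillProb

variable {V W ι : Type*} [DecidableEq V] [DecidableEq W] [DecidableEq ι]

/-- Probability that the set of free holes is `X` after `m` balls chosen one after the other,
uniformly without replacement in `B`, have been activated, starting from the set of holes `T`;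
`q T v h` is the probability that the ball at `v` fills the hole `h` when `T` is the set of free
holes. -/
noncomputable def fillProb (q : Finset V → V → V → ℝ) (X : Finset V) :
    ℕ → Finset V → Finset V → ℝ
  | 0, _, T => if T = X then 1 else 0
  | m + 1, B, T =>
      (1 / ((m : ℝ) + 1)) *
        ∑ v ∈ B, ∑ h ∈ T, q T v h * fillProb q X m (B.erase v) (T.erase h)

theorem fillProb_eq_zero_of_card (q : Finset V → V → V → ℝ) (X : Finset V) (m : ℕ) :
    ∀ B T : Finset V, T.card ≠ X.card + m → fillProb q X m B T = 0 := by
  induction m with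
  | zero =>
    intro B T h
    rw [fillProb, if_neg]
    rintro rfl
    exact h rfl
  | succ m ih =>
    intro B T h
    rw [fillProb, Finset.sum_eq_zero, mul_zero]
    intro v _
    refine Finset.sum_eq_zero fun w hw => ?_
    rw [ih, mul_zero]
    have := Finset.card_erase_add_one hw
    omega

theorem fillProb_eq_zero_of_not_subset (q : Finset V → V → V → ℝ) (X : Finset V) (m : ℕ) :
    ∀ B T : Finset V, ¬ X ⊆ T → fillProb q X m B T = 0 := by
  induction m with
  | zero =>
    intro B T h
    rw [fillProb, if_neg]
    rintro rfl
    exact h subset_rfl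
  | succ m ih =>
    intro B T h
    rw [fillProb, Finset.sum_eq_zero, mul_zero]
    intro v _
    refine Finset.sum_eq_zero fun w hw => ?_
    rw [ih _ _ fun hs => h (hs.trans (Finset.erase_subset _ _)), mul_zero]

/-- Summing over the position of the last free hole. -/
theorem sum_fillProb_singleton [Fintype V] (q : Finset V → V → V → ℝ)
    (hq : ∀ T v, T.Nonempty → ∑ h ∈ T, q T v h = 1) (m : ℕ) :
    ∀ B T : Finset V, B.card = m → T.card = m + 1 → ∑ x, fillProb q {x} m B T = 1 := by
  induction m with
  | zero =>
    intro B T _ hT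
    obtain ⟨y, rfl⟩ := Finset.card_eq_one.mp hT
    simp [fillProb]
  | succ m ih =>
    intro B T hB hT
    simp only [fillProb]
    rw [← Finset.mul_sum, Finset.sum_comm]
    have key : ∀ v ∈ B, ∑ x, ∑ h ∈ T, q T v h * fillProb q {x} m (B.erase v) (T.erase h) = 1 := by
      intro v hv
      rw [Finset.sum_comm, ← hq T v (Finset.card_pos.mp (by omega))]
      refine Finset.sum_congr rfl fun h hh => ?_
      rw [← Finset.mul_sum, ih, mul_one]
      · rw [Finset.card_erase_of_mem hv, hB, Nat.add_sub_cancel]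
      · rw [Finset.card_erase_of_mem hh, hT, Nat.add_sub_cancel]
    rw [Finset.sum_congr rfl key, Finset.sum_const, hB]
    have : (m : ℝ) + 1 ≠ 0 := by positivity
    simp [this]

theorem fillProb_map (q : Finset V → V → V → ℝ) (q' : Finset W → W → W → ℝ) (ψ : V ↪ W)
    (D X : Finset V)
    (hq : ∀ T v h, T ⊆ D → v ∈ D → h ∈ T → q' (T.map ψ) (ψ v) (ψ h) = q T v h) (m : ℕ) :
    ∀ B T : Finset V, B ⊆ D → T ⊆ D →
      fillProb q' (X.map ψ) m (B.map ψ) (T.map ψ) = fillProb q X m B T := by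
  induction m with
  | zero =>
    intro B T _ _
    simp [fillProb]
  | succ m ih =>
    intro B T hB hT
    simp only [fillProb, Finset.sum_map]
    congr 1
    refine Finset.sum_congr rfl fun v hv => Finset.sum_congr rfl fun h hh => ?_
    rw [hq T v h hT (hB hv) hh, ← Finset.map_erase, ← Finset.map_erase,
      ih _ _ ((Finset.erase_subset _ _).trans hB) ((Finset.erase_subset _ _).trans hT)]

/-- The kernel seen from outside `X`, when the holes of `X` must never be filled. -/
def avoidKernel (q : Finset V → V → V → ℝ) (X T : Finset V) (v h : V) : ℝ :=
  if v ∈ X ∨ h ∈ X then 0 else q (T ∪ X) v h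

theorem fillProb_union (q : Finset V → V → V → ℝ) (X : Finset V) (m : ℕ) :
    ∀ B T : Finset V, Disjoint B X → Disjoint T X →
      fillProb q X m B (T ∪ X) = fillProb (avoidKernel q X) ∅ m B T := by
  induction m with
  | zero =>
    intro B T _ hT
    simp only [fillProb]
    congr 1
    rw [Finset.union_eq_right, eq_iff_iff]
    constructor
    · intro h
      exact Finset.disjoint_self_iff_empty T |>.mp (hT.mono_right h)
    · rintro rfl
      exact Finset.empty_subset _
  | succ m ih =>
    intro B T hB hT
    simp only [fillProb]
    congr 1
    refine Finset.sum_congr rfl fun v hv => ?_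
    have hvX : v ∉ X := Finset.disjoint_left.mp hB hv
    rw [Finset.sum_union hT]
    have hz : ∑ h ∈ X, q (T ∪ X) v h * fillProb q X m (B.erase v) ((T ∪ X).erase h) = 0 := by
      refine Finset.sum_eq_zero fun h hh => ?_
      rw [fillProb_eq_zero_of_not_subset, mul_zero]
      intro hs
      exact Finset.notMem_erase h _ (hs hh)
    rw [hz, add_zero]
    refine Finset.sum_congr rfl fun h hh => ?_
    have hhX : h ∉ X := Finset.disjoint_left.mp hT hh
    rw [avoidKernel, if_neg (by tauto), Finset.erase_union_distrib, Finset.erase_eq_of_notMem hhX,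
      ih _ _ (hB.mono_left (Finset.erase_subset _ _)) (hT.mono_left (Finset.erase_subset _ _))]

/-- If balls and holes of different colours do not interact, then the different colours
contribute independently. -/
theorem fillProb_eq_prod [Fintype ι] (q : Finset V → V → V → ℝ) (κ : V → ι)
    (hq : ∀ T v h, h ∈ T → q T v h =
      if κ h = κ v then q (T.filter fun w => κ w = κ v) v h else 0) (m : ℕ) :
    ∀ B T : Finset V, B.card = m → fillProb q ∅ m B T =
      ∏ i, fillProb q ∅ (B.filter fun v => κ v = i).card
        (B.filter fun v => κ v = i) (T.filter fun v => κ v = i) := by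
  induction m with
  | zero =>
    intro B T hB
    obtain rfl := Finset.card_eq_zero.mp hB
    simp only [fillProb, Finset.filter_empty, Finset.card_empty]
    by_cases hT : T = ∅
    · simp [hT]
    · obtain ⟨v, hv⟩ := Finset.nonempty_iff_ne_empty.mpr hT
      rw [if_neg hT, eq_comm]
      refine Finset.prod_eq_zero (Finset.mem_univ (κ v)) (if_neg ?_)
      exact Finset.ne_empty_of_mem (Finset.mem_filter.mpr ⟨hv, rfl⟩)
  | succ m ih =>
    intro B T hB
    set Bf : ι → Finset V := fun i => B.filter fun v => κ v = i with hBf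
    set Tf : ι → Finset V := fun i => T.filter fun v => κ v = i with hTf
    have hrec : ∀ i, ((Bf i).card : ℝ) * fillProb q ∅ (Bf i).card (Bf i) (Tf i) =
        ∑ v ∈ Bf i, ∑ h ∈ Tf i, q (Tf i) v h *
          fillProb q ∅ ((Bf i).erase v).card ((Bf i).erase v) ((Tf i).erase h) := by
      intro i
      cases hc : (Bf i).card with
      | zero =>
        rw [Finset.card_eq_zero.mp hc]
        simp
      | succ k =>
        have : (k : ℝ) + 1 ≠ 0 := by positivity
        rw [fillProb, ← mul_assoc, Nat.cast_succ, mul_one_div_cancel this, one_mul]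
        refine Finset.sum_congr rfl fun v hv => Finset.sum_congr rfl fun h hh => ?_
        rw [Finset.card_erase_of_mem hv, hc, Nat.add_sub_cancel]
    have hterm : ∀ i, ∀ v ∈ Bf i, ∑ h ∈ T, q T v h * fillProb q ∅ m (B.erase v) (T.erase h) =
        (∑ h ∈ Tf i, q (Tf i) v h *
          fillProb q ∅ ((Bf i).erase v).card ((Bf i).erase v) ((Tf i).erase h)) *
        ∏ j ∈ Finset.univ.erase i, fillProb q ∅ (Bf j).card (Bf j) (Tf j) := by
      intro i v hv
      obtain ⟨hvB, rfl⟩ := Finset.mem_filter.mp hv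
      rw [Finset.sum_mul, hTf, Finset.sum_filter]
      refine Finset.sum_congr rfl fun h hh => ?_
      rw [hq T v h hh]
      split_ifs with hκ
      · rw [ih (B.erase v) (T.erase h) (by rw [Finset.card_erase_of_mem hvB, hB]; rfl),
          ← Finset.mul_prod_erase _ _ (Finset.mem_univ (κ v)), mul_assoc]
        congr 2
        · rw [Finset.filter_erase, Finset.filter_erase]
        · refine Finset.prod_congr rfl fun j hj => ?_
          have hj' : κ v ≠ j := (Finset.ne_of_mem_erase hj).symm
          have h1 : (B.erase v).filter (fun w => κ w = j) = Bf j := by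
            rw [Finset.filter_erase, Finset.erase_eq_of_notMem]
            simp [hj']
          have h2 : (T.erase h).filter (fun w => κ w = j) = T.filter fun w => κ w = j := by
            rw [Finset.filter_erase, Finset.erase_eq_of_notMem]
            simp [hκ, hj']
          rw [h1, h2]
      · rw [zero_mul]
    rw [fillProb, ← Finset.sum_fiberwise B κ]
    have hfib : ∀ i, ∑ v ∈ B.filter (fun v => κ v = i),
        ∑ h ∈ T, q T v h * fillProb q ∅ m (B.erase v) (T.erase h) =
        (Bf i).card * ∏ j, fillProb q ∅ (Bf j).card (Bf j) (Tf j) := by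
      intro i
      rw [Finset.sum_congr rfl (hterm i), ← Finset.sum_mul, ← hrec i, mul_assoc,
        Finset.mul_prod_erase Finset.univ (fun j => fillProb q ∅ (Bf j).card (Bf j) (Tf j))
          (Finset.mem_univ i)]
    rw [Finset.sum_congr rfl fun i _ => hfib i, ← Finset.sum_mul]
    have hcard : (∑ i, ((Bf i).card : ℝ)) = (m : ℝ) + 1 := by
      rw [← Nat.cast_sum, Finset.sum_card_fiberwise_eq_card_filter B Finset.univ κ]
      simp [hB]
    have : (m : ℝ) + 1 ≠ 0 := by positivity
    rw [hcard, ← mul_assoc, one_div_mul_cancel this, one_mul]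

end FillProb

section Kernel

variable {n : ℕ}

/-- Probability that the ball at `v` fills the hole `h` when `H` is the set of free holes. -/
noncomputable def golfKernel (p : ℝ) (H : Finset (Fin n)) (v h : Fin n) : ℝ :=
  (if h = shiftR v (distR H v) then rightProb p H v else 0) +
    if h = shiftL v (distL H v) then 1 - rightProb p H v else 0

theorem rightProb_congr {n' : ℕ} (p : ℝ) {H : Finset (Fin n)} {H' : Finset (Fin n')} {v : Fin n}
    {v' : Fin n'} (hR : distR H v = distR H' v') (hL : distL H v = distL H' v') :
    rightProb p H v = rightProb p H' v' := by
  rw [rightProb, rightProb, hR, hL]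

theorem sum_golfKernel_mul (p : ℝ) {H : Finset (Fin n)} (hH : H.Nonempty) (v : Fin n)
    (F : Fin n → ℝ) :
    ∑ h ∈ H, golfKernel p H v h * F h =
      rightProb p H v * F (shiftR v (distR H v)) +
        (1 - rightProb p H v) * F (shiftL v (distL H v)) := by
  simp only [golfKernel, add_mul, ite_mul, zero_mul]
  rw [Finset.sum_add_distrib, Finset.sum_ite_eq', Finset.sum_ite_eq',
    if_pos (distR_spec hH v).2.2.1, if_pos (distL_spec hH v).2.2.1]

theorem sum_golfKernel (p : ℝ) (H : Finset (Fin n)) (v : Fin n) (hH : H.Nonempty) :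
    ∑ h ∈ H, golfKernel p H v h = 1 := by
  have := sum_golfKernel_mul p hH v fun _ => 1
  simpa using this

/-- Probability that the final set of holes is `X` when the balls are activated in the order
given by `f`. -/
noncomputable def orderedProb (p : ℝ) (X : Finset (Fin n)) (m : ℕ) (f : Fin m → Fin n)
    (T : Finset (Fin n)) : ℝ :=
  ∑ cs : Fin m → Bool, golfWeight p (List.ofFn f) (List.ofFn cs) T *
    if golfRun (List.ofFn f) (List.ofFn cs) T = X then 1 else 0

theorem orderedProb_zero (p : ℝ) (X : Finset (Fin n)) (f : Fin 0 → Fin n)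
    (T : Finset (Fin n)) : orderedProb p X 0 f T = if T = X then 1 else 0 := by
  simp [orderedProb, golfWeight, golfRun]

theorem orderedProb_succ (p : ℝ) (X : Finset (Fin n)) (m : ℕ) (f : Fin (m + 1) → Fin n)
    {T : Finset (Fin n)} (hT : T.Nonempty) :
    orderedProb p X (m + 1) f T =
      ∑ h ∈ T, golfKernel p T (f 0) h * orderedProb p X m (fun i => f i.succ) (T.erase h) := by
  rw [sum_golfKernel_mul p hT, orderedProb,
    ← (Fin.consEquiv fun _ => Bool).sum_comp, Fintype.sum_prod_type, Fintype.sum_bool]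
  simp only [orderedProb, Finset.mul_sum]
  congr 1 <;>
  · refine Finset.sum_congr rfl fun cs _ => ?_
    simp [List.ofFn_succ, golfWeight, golfRun, golfStep]

theorem sum_orderedProb (p : ℝ) (X : Finset (Fin n)) (m : ℕ) :
    ∀ B T : Finset (Fin n), m ≤ T.card →
      ∑ f : Fin m ↪ Fin n with Finset.univ.map f = B, orderedProb p X m f T =
        if B.card = m then (m.factorial : ℝ) * fillProb (golfKernel p) X m B T else 0 := by
  induction m with
  | zero =>
    intro B T _
    simp only [orderedProb_zero, fillProb]
    by_cases hB : B = ∅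
    · subst hB
      simp
    · simp [hB, eq_comm]
  | succ m ih =>
    intro B T hT
    have hTne : T.Nonempty := Finset.card_pos.mp (by omega)
    split_ifs with hB
    · have hfib : ∑ f : Fin (m + 1) ↪ Fin n with Finset.univ.map f = B,
          orderedProb p X (m + 1) f T =
          ∑ v ∈ B, ∑ g : Fin m ↪ Fin n with Finset.univ.map g = B.erase v,
            ∑ h ∈ T, golfKernel p T v h * orderedProb p X m g (T.erase h) := by
        rw [← Finset.sum_fiberwise_of_maps_to (t := B) (g := fun f => f 0)]
        · refine Finset.sum_congr rfl fun v hv => ?_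
          have hnot : ∀ g ∈ Finset.univ.filter
              (fun g : Fin m ↪ Fin n => Finset.univ.map g = B.erase v), v ∉ Set.range g := by
            rintro g hg ⟨i, hi⟩
            have : g i ∈ Finset.univ.map g := Finset.mem_map_of_mem g (Finset.mem_univ i)
            rw [(Finset.mem_filter.mp hg).2, hi] at this
            exact Finset.notMem_erase v B this
          refine (Finset.sum_bij (fun g hg => Fin.Embedding.cons g (hnot g hg)) ?_ ?_ ?_ ?_).symm
          · intro g hg
            simp only [Finset.mem_filter, Finset.mem_univ, true_and] at hg ⊢
            refine ⟨?_, rfl⟩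
            ext w
            simp only [Finset.mem_map, Finset.mem_univ, true_and, Fin.exists_fin_succ]
            have hw := Finset.ext_iff.mp hg w
            simp only [Finset.mem_map, Finset.mem_univ, true_and, Finset.mem_erase] at hw
            simp only [Fin.Embedding.coe_cons, Fin.cons_zero, Fin.cons_succ, hw]
            by_cases hwv : w = v
            · simp [hwv, hv]
            · simp [hwv, Ne.symm hwv]
          · intro g hg g' hg' h
            ext i
            have := congrArg (fun e : Fin (m + 1) ↪ Fin n => (e i.succ).val) h
            simpa using this
          · intro f hf
            simp only [Finset.mem_filter, Finset.mem_univ, true_and] at hf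
            refine ⟨Fin.Embedding.tail f, ?_, ?_⟩
            · simp only [Finset.mem_filter, Finset.mem_univ, true_and]
              ext w
              rw [← hf.1, ← hf.2]
              simp only [Finset.mem_map, Finset.mem_univ, true_and, Finset.mem_erase,
                Fin.exists_fin_succ, Fin.Embedding.coe_tail, Fin.tail]
              constructor
              · rintro ⟨i, rfl⟩
                exact ⟨fun h => Fin.succ_ne_zero i (f.injective h), Or.inr ⟨i, rfl⟩⟩
              · rintro ⟨h1, h2 | h2⟩
                · exact absurd h2.symm h1
                · exact h2
            · ext i
              refine Fin.cases ?_ (fun j => ?_) i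
              · simp [hf.2]
              · simp [Fin.tail]
          · intro g hg
            rw [orderedProb_succ p X m _ hTne]
            simp
        · intro f hf
          rw [← (Finset.mem_filter.mp hf).2]
          exact Finset.mem_map_of_mem f (Finset.mem_univ 0)
      rw [hfib, fillProb, Nat.factorial_succ, Nat.cast_mul, Nat.cast_succ]
      have hm : (m : ℝ) + 1 ≠ 0 := by positivity
      rw [mul_comm ((m : ℝ) + 1) (m.factorial : ℝ), mul_assoc, ← mul_assoc ((m : ℝ) + 1),
        mul_one_div_cancel hm, one_mul, Finset.mul_sum]
      refine Finset.sum_congr rfl fun v hv => ?_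
      rw [Finset.sum_comm, Finset.mul_sum]
      refine Finset.sum_congr rfl fun h hh => ?_
      rw [← Finset.mul_sum, ih _ _ (by rw [Finset.card_erase_of_mem hh]; omega),
        if_pos (by rw [Finset.card_erase_of_mem hv, hB]; rfl)]
      ring
    · refine Finset.sum_eq_zero fun f hf => absurd ?_ hB
      rw [← (Finset.mem_filter.mp hf).2, Finset.card_map, Finset.card_univ, Fintype.card_fin]

/-- Pairs of disjoint sets of balls and holes inside `D`, with `b` balls. -/
def ballHolePairs {V : Type*} [DecidableEq V] (D : Finset V) (b : ℕ) :
    Finset (Finset V × Finset V) :=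
  (D.powerset ×ˢ D.powerset).filter fun c => Disjoint c.1 c.2 ∧ c.1.card = b

theorem mem_ballHolePairs {V : Type*} [DecidableEq V] {D : Finset V} {b : ℕ}
    {c : Finset V × Finset V} :
    c ∈ ballHolePairs D b ↔ c.1 ⊆ D ∧ c.2 ⊆ D ∧ Disjoint c.1 c.2 ∧ c.1.card = b := by
  simp [ballHolePairs, and_assoc]

theorem sum_golfInit (p : ℝ) (X : Finset (Fin n)) {nb nt : ℕ} (h : nb < nt) :
    ∑ c ∈ golfInit n nb nt, orderedProb p X nb c.1 c.2 =
      (nb.factorial : ℝ) * ∑ c ∈ (ballHolePairs Finset.univ nb).filter (fun c => c.2.card = nt),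
        fillProb (golfKernel p) X nb c.1 c.2 := by
  rw [← Finset.sum_fiberwise_of_maps_to
    (t := (ballHolePairs Finset.univ nb).filter fun c => c.2.card = nt)
    (g := fun c => (Finset.univ.map c.1, c.2)), Finset.mul_sum]
  · refine Finset.sum_congr rfl fun c hc => ?_
    simp only [Finset.mem_filter, mem_ballHolePairs, Finset.subset_univ, true_and] at hc
    have := sum_orderedProb p X nb c.1 c.2 (by omega)
    rw [if_pos hc.1.2] at this
    rw [← this]
    refine Finset.sum_nbij' (fun c => c.1) (fun f => (f, c.2)) ?_ ?_ ?_ ?_ ?_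
    · rintro ⟨f, T⟩ hf
      simp only [Finset.mem_filter, Prod.ext_iff] at hf
      simp [hf.2.1]
    · intro f hf
      simp only [Finset.mem_filter, Finset.mem_univ, true_and] at hf
      simp only [golfInit, Finset.mem_filter, Finset.mem_univ, true_and, Prod.ext_iff, hf, hc.2,
        and_true]
      intro i
      refine Finset.disjoint_left.mp hc.1.1 ?_
      rw [← hf]
      exact Finset.mem_map_of_mem f (Finset.mem_univ i)
    · rintro ⟨f, T⟩ hf
      simp only [Finset.mem_filter, Prod.ext_iff] at hf
      simp [hf.2.2]
    · intro f _
      rfl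
    · rintro ⟨f, T⟩ hf
      simp only [Finset.mem_filter, Prod.ext_iff] at hf
      simp [hf.2.2]
  · rintro ⟨f, T⟩ hf
    simp only [golfInit, Finset.mem_filter, Finset.mem_univ, true_and] at hf
    simp only [Finset.mem_filter, mem_ballHolePairs, Finset.subset_univ, true_and, hf.1,
      Finset.card_map, Finset.card_univ, Fintype.card_fin, and_true]
    rw [Finset.disjoint_left]
    intro v hv
    obtain ⟨i, -, rfl⟩ := Finset.mem_map.mp hv
    exact hf.2 i

theorem card_golfInit (n nb nt : ℕ) :
    (golfInit n nb nt).card = n.descFactorial nb * (n - nb).choose nt := by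
  rw [golfInit, Finset.card_filter, Fintype.sum_prod_type]
  have key : ∀ f : Fin nb ↪ Fin n, ∑ T : Finset (Fin n),
      (if T.card = nt ∧ ∀ i, f i ∉ T then 1 else 0) = (n - nb).choose nt := by
    intro f
    rw [← Finset.card_filter]
    have : (Finset.univ.filter fun T : Finset (Fin n) => T.card = nt ∧ ∀ i, f i ∉ T) =
        Finset.powersetCard nt (Finset.univ.map f)ᶜ := by
      ext T
      simp only [Finset.mem_filter, Finset.mem_univ, true_and, Finset.mem_powersetCard]
      rw [and_comm, and_congr_left_iff]
      intro _
      constructor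
      · intro h v hv
        simp only [Finset.mem_compl, Finset.mem_map, Finset.mem_univ, true_and, not_exists]
        rintro i rfl
        exact h i hv
      · intro h i hi
        have := h hi
        simp at this
    rw [this, Finset.card_powersetCard, Finset.card_compl]
    simp
  rw [Finset.sum_congr rfl fun f _ => key f, Finset.sum_const, Finset.card_univ,
    Fintype.card_embedding_eq]
  simp

theorem card_ballHolePairs {V : Type*} [DecidableEq V] (D : Finset V) (b t : ℕ) :
    ((ballHolePairs D b).filter fun c => c.2.card = t).card =
      D.card.choose b * (D.card - b).choose t := by
  rw [Finset.card_eq_sum_card_fiberwise (f := Prod.fst) (t := Finset.powersetCard b D)]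
  · have key : ∀ B ∈ Finset.powersetCard b D,
        (((ballHolePairs D b).filter fun c => c.2.card = t).filter fun c => c.1 = B).card =
          (D.card - b).choose t := by
      intro B hB
      rw [Finset.mem_powersetCard] at hB
      rw [← hB.2, ← Finset.card_sdiff_of_subset hB.1, ← Finset.card_powersetCard]
      refine Finset.card_nbij' (fun c => c.2) (fun T => (B, T)) ?_ ?_ ?_ ?_
      · rintro ⟨B', T⟩ h
        simp only [Finset.coe_filter, Finset.mem_filter, mem_ballHolePairs,
          Set.mem_ofPred_eq] at h
        obtain ⟨⟨⟨h1, h2, h3, h4⟩, h5⟩, rfl⟩ := h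
        simp only [Finset.mem_coe, Finset.mem_powersetCard]
        exact ⟨Finset.subset_sdiff.mpr ⟨h2, h3.symm⟩, h5⟩
      · intro T hT
        simp only [Finset.mem_coe, Finset.mem_powersetCard, Finset.subset_sdiff] at hT
        simp only [Finset.coe_filter, Finset.mem_filter, mem_ballHolePairs, Set.mem_ofPred_eq]
        exact ⟨⟨⟨hB.1, hT.1.1, hT.1.2.symm, trivial⟩, hT.2⟩, trivial⟩
      · rintro ⟨B', T⟩ h
        simp only [Finset.coe_filter, Finset.mem_filter, Set.mem_ofPred_eq] at h
        simp [h.2]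
      · intro T _
        rfl
    rw [Finset.sum_congr rfl key, Finset.sum_const, Finset.card_powersetCard, smul_eq_mul]
  · rintro ⟨B, T⟩ h
    simp only [Finset.coe_filter, mem_ballHolePairs, Set.mem_ofPred_eq] at h
    simp only [Finset.mem_coe, Finset.mem_powersetCard]
    exact ⟨h.1.1, h.1.2.2.2⟩

end Kernel

section BlockSum

theorem sum_fillProb_avoid {V : Type*} [DecidableEq V] [Fintype V] (q : Finset V → V → V → ℝ)
    (X : Finset V) (b : ℕ) :
    ∑ c ∈ (ballHolePairs Finset.univ b).filter (fun c => c.2.card = X.card + b),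
        fillProb q X b c.1 c.2 =
      ∑ c ∈ ballHolePairs Xᶜ b, fillProb (avoidKernel q X) ∅ b c.1 c.2 := by
  symm
  have hmem : ∀ c : Finset V × Finset V, c ∈ ballHolePairs Xᶜ b →
      Disjoint c.1 X ∧ Disjoint c.2 X ∧ Disjoint c.1 c.2 ∧ c.1.card = b := by
    intro c hc
    rw [mem_ballHolePairs] at hc
    exact ⟨Finset.subset_compl_iff_disjoint_right.mp hc.1,
      Finset.subset_compl_iff_disjoint_right.mp hc.2.1, hc.2.2⟩
  refine Finset.sum_bij_ne_zero (fun c _ _ => (c.1, c.2 ∪ X)) ?_ ?_ ?_ ?_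
  · intro c hc hne
    obtain ⟨h1, h2, h3, h4⟩ := hmem c hc
    have hcard : c.2.card = b := by
      by_contra h
      exact hne (fillProb_eq_zero_of_card _ _ _ _ _ (by simpa using h))
    simp only [Finset.mem_filter, mem_ballHolePairs, Finset.subset_univ, true_and]
    exact ⟨⟨Finset.disjoint_union_right.mpr ⟨h3, h1⟩, h4⟩, by
      rw [Finset.card_union_of_disjoint h2, hcard, add_comm]⟩
  · intro c hc _ c' hc' _ h
    obtain ⟨h1, h2⟩ := Prod.ext_iff.mp h
    refine Prod.ext h1 ?_
    have h3 : (c.2 ∪ X) \ X = (c'.2 ∪ X) \ X := by rw [show c.2 ∪ X = c'.2 ∪ X from h2]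
    rwa [Finset.union_sdiff_cancel_right (hmem c hc).2.1,
      Finset.union_sdiff_cancel_right (hmem c' hc').2.1] at h3
  · rintro ⟨B, T⟩ hc hne
    simp only [Finset.mem_filter, mem_ballHolePairs, Finset.subset_univ, true_and] at hc
    have hXT : X ⊆ T := by
      by_contra h
      exact hne (fillProb_eq_zero_of_not_subset _ _ _ _ _ h)
    have hBX : Disjoint B X := hc.1.1.mono_right hXT
    refine ⟨(B, T \ X), ?_, ?_, ?_⟩
    · rw [mem_ballHolePairs]
      exact ⟨Finset.subset_compl_iff_disjoint_right.mpr hBX,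
        Finset.subset_compl_iff_disjoint_right.mpr Finset.sdiff_disjoint,
        hc.1.1.mono_right Finset.sdiff_subset, hc.1.2⟩
    · rw [← fillProb_union _ _ _ _ _ hBX Finset.sdiff_disjoint, Finset.sdiff_union_of_subset hXT]
      exact hne
    · simp [Finset.sdiff_union_of_subset hXT]
  · intro c hc _
    obtain ⟨h1, h2, -, -⟩ := hmem c hc
    rw [fillProb_union _ _ _ _ _ h1 h2]

theorem sum_ballHolePairs_map {V W : Type*} [DecidableEq V] [DecidableEq W] (ψ : V ↪ W)
    (D : Finset V) (b : ℕ) (F : Finset W → Finset W → ℝ) :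
    ∑ c ∈ ballHolePairs (D.map ψ) b, F c.1 c.2 =
      ∑ c ∈ ballHolePairs D b, F (c.1.map ψ) (c.2.map ψ) := by
  symm
  refine Finset.sum_bij (fun c _ => (c.1.map ψ, c.2.map ψ)) ?_ ?_ ?_ ?_
  · intro c hc
    rw [mem_ballHolePairs] at hc ⊢
    simpa using hc
  · intro c _ c' _ h
    obtain ⟨h1, h2⟩ := Prod.ext_iff.mp h
    exact Prod.ext (Finset.map_injective ψ h1) (Finset.map_injective ψ h2)
  · rintro ⟨B, T⟩ hc
    rw [mem_ballHolePairs] at hc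
    obtain ⟨h1, h2, h3, h4⟩ := hc
    obtain ⟨B', hB', rfl⟩ := Finset.subset_map_iff.mp h1
    obtain ⟨T', hT', rfl⟩ := Finset.subset_map_iff.mp h2
    refine ⟨(B', T'), ?_, rfl⟩
    rw [mem_ballHolePairs]
    exact ⟨hB', hT', by simpa using h3, by simpa using h4⟩
  · intro c _
    rfl

variable {n : ℕ}

/-- Rotation of the cycle by `c` steps in the positive direction. -/
def rotation (n c : ℕ) : Fin n ↪ Fin n := ⟨fun v => shiftR v c, shiftR_injective c⟩

theorem golfKernel_rotation (p : ℝ) (c : ℕ) {T : Finset (Fin n)} (v : Fin n) {h : Fin n}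
    (hh : h ∈ T) :
    golfKernel p (T.map (rotation n c)) (rotation n c v) (rotation n c h) =
      golfKernel p T v h := by
  have hn : 0 < n := Nat.lt_of_le_of_lt (Nat.zero_le _) v.isLt
  have hR : ∀ d, shiftR (rotation n c v) d = rotation n c (shiftR v d) := by
    intro d
    simp only [rotation, Function.Embedding.coeFn_mk, shiftR_shiftR, add_comm]
  have hL : ∀ d, shiftL (rotation n c v) d = rotation n c (shiftL v d) := by
    intro d
    rw [shiftL_eq_iff]
    simp only [rotation, Function.Embedding.coeFn_mk, shiftR_shiftR]
    rw [add_comm, ← shiftR_shiftR, shiftR_shiftL_self]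
  obtain ⟨-, r2, r3, -⟩ := distR_spec ⟨h, hh⟩ v
  obtain ⟨-, l2, l3, -⟩ := distL_spec ⟨h, hh⟩ v
  have eR : distR T v = distR (T.map (rotation n c)) (rotation n c v) :=
    distR_congr (distR_spec ⟨h, hh⟩ v).1 r2 r3 fun d _ _ => by
      rw [hR, Finset.mem_map']
  have eL : distL T v = distL (T.map (rotation n c)) (rotation n c v) :=
    distL_congr (distL_spec ⟨h, hh⟩ v).1 l2 l3 fun d _ _ => by
      rw [hL, Finset.mem_map']
  rw [golfKernel, golfKernel, ← rightProb_congr p eR eL, ← eR, ← eL, hR, hL]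
  simp only [EmbeddingLike.apply_eq_iff_eq]

theorem sum_fillProb_rotation (p : ℝ) (b : ℕ) (x y : Fin n) :
    ∑ c ∈ (ballHolePairs Finset.univ b).filter (fun c => c.2.card = b + 1),
        fillProb (golfKernel p) {y} b c.1 c.2 =
      ∑ c ∈ (ballHolePairs Finset.univ b).filter (fun c => c.2.card = b + 1),
        fillProb (golfKernel p) {x} b c.1 c.2 := by
  obtain ⟨d, -, -, rfl⟩ := exists_shiftR_eq x y
  have huniv : (Finset.univ : Finset (Fin n)) = Finset.univ.map (rotation n d) :=
    (Finset.eq_univ_of_card _ (by simp)).symm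
  have hs : ({shiftR x d} : Finset (Fin n)) = ({x} : Finset (Fin n)).map (rotation n d) := by
    simp [rotation]
  rw [Finset.sum_filter, Finset.sum_filter]
  conv_lhs => rw [huniv, hs]
  rw [sum_ballHolePairs_map (rotation n d) Finset.univ b fun B T =>
    if T.card = b + 1 then
      fillProb (golfKernel p) (({x} : Finset (Fin n)).map (rotation n d)) b B T else 0]
  refine Finset.sum_congr rfl fun c _ => ?_
  rw [Finset.card_map, fillProb_map (golfKernel p) (golfKernel p) (rotation n d) Finset.univ {x}
    (fun T v h _ _ hh => golfKernel_rotation p d v hh) b _ _ (Finset.subset_univ _)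
    (Finset.subset_univ _)]

/-- On a cycle with one more hole than balls, the last free hole is uniform. -/
theorem card_mul_sum_fillProb_singleton (p : ℝ) (b : ℕ) (x : Fin n) :
    (n : ℝ) * ∑ c ∈ (ballHolePairs Finset.univ b).filter (fun c => c.2.card = b + 1),
        fillProb (golfKernel p) {x} b c.1 c.2 = n.choose b * (n - b).choose (b + 1) := by
  have h1 : ∑ y : Fin n, ∑ c ∈ (ballHolePairs Finset.univ b).filter (fun c => c.2.card = b + 1),
      fillProb (golfKernel p) {y} b c.1 c.2 = n.choose b * (n - b).choose (b + 1) := by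
    rw [Finset.sum_comm]
    have key : ∀ c ∈ (ballHolePairs (Finset.univ : Finset (Fin n)) b).filter
        (fun c => c.2.card = b + 1), ∑ y, fillProb (golfKernel p) {y} b c.1 c.2 = 1 := by
      intro c hc
      simp only [Finset.mem_filter, mem_ballHolePairs] at hc
      exact sum_fillProb_singleton _ (fun T v hT => sum_golfKernel p T v hT) b _ _
        hc.1.2.2.2 hc.2
    rw [Finset.sum_congr rfl key, Finset.sum_const, card_ballHolePairs]
    simp
  rw [← h1, Finset.sum_congr rfl fun y _ => sum_fillProb_rotation p b x y, Finset.sum_const]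
  simp

theorem sum_fillProb_avoid_singleton (p : ℝ) (b : ℕ) (x : Fin n) :
    ∑ c ∈ ballHolePairs {x}ᶜ b, fillProb (avoidKernel (golfKernel p) {x}) ∅ b c.1 c.2 =
      if 2 * b ≤ n - 1 then
        (1 / ((b : ℝ) + 1)) * (multinom3 b b (n - 1 - 2 * b) : ℝ) else 0 := by
  have hn : 0 < n := Nat.lt_of_le_of_lt (Nat.zero_le _) x.isLt
  have hn' : (n : ℝ) ≠ 0 := by positivity
  have h := card_mul_sum_fillProb_singleton p b x
  rw [← sum_fillProb_avoid, Finset.card_singleton, add_comm 1 b]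
  split_ifs with hb
  · obtain ⟨r, hr⟩ : ∃ r, n = 2 * b + 1 + r := ⟨n - (2 * b + 1), by omega⟩
    have hr' : n - 1 - 2 * b = r := by omega
    have c1 := Nat.choose_mul_factorial_mul_factorial (show b ≤ n by omega)
    have c2 := Nat.choose_mul_factorial_mul_factorial (show b + 1 ≤ n - b by omega)
    have hr2 : n - b - (b + 1) = r := by omega
    rw [hr2] at c2
    rw [hr', multinom3, show b + b + r = n - 1 by omega]
    have hdvd : b.factorial * b.factorial * r.factorial ∣ (n - 1).factorial := by
      have h1 := Nat.factorial_mul_factorial_dvd_factorial_add b b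
      have h2 := Nat.factorial_mul_factorial_dvd_factorial_add (b + b) r
      rw [show b + b + r = n - 1 by omega] at h2
      exact (Nat.mul_dvd_mul_right h1 _).trans h2
    rw [Nat.cast_div hdvd (by positivity)]
    have c3 : n * (n - 1).factorial = n.factorial := Nat.mul_factorial_pred (by omega)
    have c4 : (b + 1).factorial = (b + 1) * b.factorial := Nat.factorial_succ b
    rw [c4] at c2
    apply mul_left_cancel₀ hn'
    rw [h]
    have d1 : ((n.choose b : ℝ) * b.factorial * (n - b).factorial) = n.factorial := by
      exact_mod_cast c1
    have d2 : (((n - b).choose (b + 1) : ℝ) * ((b + 1) * b.factorial) * r.factorial) =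
        (n - b).factorial := by exact_mod_cast c2
    have d3 : (n : ℝ) * (n - 1).factorial = n.factorial := by exact_mod_cast c3
    have e1 : (b.factorial : ℝ) ≠ 0 := by positivity
    have e2 : (r.factorial : ℝ) ≠ 0 := by positivity
    have e3 : (b : ℝ) + 1 ≠ 0 := by positivity
    push_cast
    field_simp
    rw [d3, ← d1, ← d2]
    ring
  · rw [Nat.choose_eq_zero_of_lt (show n - b < b + 1 by omega)] at h
    simpa [hn.ne'] using h

end BlockSum

section Arc

variable {n : ℕ}

/-- The arc of the cycle from `x` up to the next element of `X`. -/
def arc (X : Finset (Fin n)) {x : Fin n} (hx : x ∈ X) : Fin (distR X x) ↪ Fin n :=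
  ⟨fun j => shiftR x j, fun i j h => Fin.ext (shiftR_left_injective x
    (i.isLt.trans_le (distR_spec ⟨x, hx⟩ x).2.1) (j.isLt.trans_le (distR_spec ⟨x, hx⟩ x).2.1) h)⟩

theorem arc_mem_iff (X : Finset (Fin n)) {x : Fin n} (hx : x ∈ X) {z : Fin (distR X x)}
    (hz : z.val = 0) (j : Fin (distR X x)) : arc X hx j ∈ X ↔ j = z := by
  constructor
  · intro h
    by_contra hne
    have hj : j.val ≠ 0 := fun h0 => hne (Fin.ext (h0.trans hz.symm))
    exact (distR_spec ⟨x, hx⟩ x).2.2.2 j (by omega) j.isLt h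
  · rintro rfl
    show shiftR x j.val ∈ X
    rw [hz, shiftR_zero]
    exact hx

theorem map_arc_compl (X : Finset (Fin n)) {x : Fin n} (hx : x ∈ X) {z : Fin (distR X x)}
    (hz : z.val = 0) :
    ({z}ᶜ : Finset (Fin (distR X x))).map (arc X hx) =
      Xᶜ.filter fun v => blockStart X v = x := by
  ext v
  simp only [Finset.mem_map, Finset.mem_compl, Finset.mem_singleton, Finset.mem_filter]
  constructor
  · rintro ⟨j, hj, rfl⟩
    have hj0 : j.val ≠ 0 := fun h0 => hj (Fin.ext (h0.trans hz.symm))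
    exact ⟨fun h => hj ((arc_mem_iff X hx hz j).mp h),
      blockStart_shiftR_of_mem hx (by omega) j.isLt⟩
  · rintro ⟨hv, rfl⟩
    obtain ⟨j, h0, hlt, hj⟩ := exists_shiftR_blockStart ⟨_, hx⟩ hv
    refine ⟨⟨j, hlt⟩, fun h => ?_, hj⟩
    have := congrArg Fin.val h
    simp only [hz] at this
    omega

/-- A block of `X` behaves like a cycle in which the two ends of the block are identified. -/
theorem avoidKernel_arc (p : ℝ) (X : Finset (Fin n)) {x : Fin n} (hx : x ∈ X)
    {z : Fin (distR X x)} (hz : z.val = 0) (T : Finset (Fin (distR X x))) (v h : Fin (distR X x))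
    (hT : T ⊆ {z}ᶜ) (hv : v ∈ ({z}ᶜ : Finset (Fin (distR X x)))) (hh : h ∈ T) :
    avoidKernel (golfKernel p) X (T.map (arc X hx)) (arc X hx v) (arc X hx h) =
      avoidKernel (golfKernel p) {z} T v h := by
  have hv' : v ≠ z := by simpa using hv
  have hh' : h ≠ z := by simpa using hT hh
  obtain ⟨-, hLn, hLX, -⟩ := distR_spec ⟨x, hx⟩ x
  have hv0 : v.val ≠ 0 := fun h0 => hv' (Fin.ext (h0.trans hz.symm))
  have hvL := v.isLt
  rw [avoidKernel, avoidKernel, if_neg (by simp [arc_mem_iff X hx hz, hv', hh']),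
    if_neg (by simp [hv', hh'])]
  have hmem : ∀ w, w ∈ T ∪ {z} ↔ arc X hx w ∈ T.map (arc X hx) ∪ X := by
    intro w
    simp [arc_mem_iff X hx hz, or_comm]
  have hR1 : ∀ d (hd : v.val + d < distR X x), shiftR v d = ⟨v.val + d, hd⟩ := fun d hd =>
    Fin.ext (Nat.mod_eq_of_lt hd)
  have hR2 : shiftR v (distR X x - v.val) = z := by
    apply Fin.ext
    simp [shiftR, Nat.add_sub_cancel' hvL.le, hz]
  have hR3 : ∀ d, shiftR (arc X hx v) d = shiftR x (v.val + d) := fun d => shiftR_shiftR _ _ _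
  have hR4 : ∀ d (hd : v.val + d < distR X x), shiftR (arc X hx v) d = arc X hx (shiftR v d) := by
    intro d hd
    rw [hR1 d hd, hR3]
    rfl
  have hR5 : shiftR (arc X hx v) (distR X x - v.val) ∈ X := by
    rw [hR3, Nat.add_sub_cancel' hvL.le]
    exact hLX
  have hL1 : ∀ d, d ≤ v.val → shiftL (arc X hx v) d = arc X hx (shiftL v d) := by
    intro d hd
    have : shiftL v d = ⟨v.val - d, by omega⟩ := by
      rw [shiftL_eq_iff]
      apply Fin.ext
      simp only [shiftR]
      rw [Nat.sub_add_cancel hd, Nat.mod_eq_of_lt hvL]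
    rw [this]
    exact shiftL_shiftR x hd
  have hL2 : shiftL v v.val = z := by
    rw [shiftL_eq_iff]
    apply Fin.ext
    simp [shiftR, hz, Nat.mod_eq_of_lt hvL]
  have hcR : shiftR v (distR X x - v.val) ∈ T ∪ {z} := by rw [hR2]; simp
  have hcL : shiftL v v.val ∈ T ∪ {z} := by rw [hL2]; simp
  have eR : distR (T ∪ {z}) v = distR (T.map (arc X hx) ∪ X) (arc X hx v) := by
    refine distR_congr (by omega) (by omega) hcR fun d _ hd => ?_
    rcases hd.lt_or_eq with hlt | rfl
    · rw [hR4 d (by omega), hmem]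
    · exact iff_of_true hcR (Finset.mem_union_right _ hR5)
  have eL : distL (T ∪ {z}) v = distL (T.map (arc X hx) ∪ X) (arc X hx v) := by
    refine distL_congr (by omega) (by omega) hcL fun d _ hd => ?_
    rw [hL1 d hd, hmem]
  have leR := distR_le (show 1 ≤ distR X x - v.val by omega) hcR
  have leL := distL_le (show 1 ≤ v.val by omega) hcL
  have iR : arc X hx h = shiftR (arc X hx v) (distR (T ∪ {z}) v) ↔
      h = shiftR v (distR (T ∪ {z}) v) := by
    rcases leR.lt_or_eq with hlt | heq
    · rw [hR4 _ (by omega), EmbeddingLike.apply_eq_iff_eq]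
    · rw [heq, hR2]
      refine iff_of_false (fun h1 => hh' ?_) hh'
      rw [← h1, arc_mem_iff X hx hz] at hR5
      exact hR5
  rw [golfKernel, golfKernel, ← rightProb_congr p eR eL, ← eR, ← eL, hL1 _ leL]
  simp only [iR, EmbeddingLike.apply_eq_iff_eq]

theorem sum_fillProb_block (p : ℝ) (X : Finset (Fin n)) {x : Fin n} (hx : x ∈ X) (b : ℕ) :
    ∑ c ∈ ballHolePairs (Xᶜ.filter fun v => blockStart X v = x) b,
        fillProb (avoidKernel (golfKernel p) X) ∅ b c.1 c.2 =
      if 2 * b ≤ distR X x - 1 then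
        (1 / ((b : ℝ) + 1)) * (multinom3 b b (distR X x - 1 - 2 * b) : ℝ) else 0 := by
  let z : Fin (distR X x) := ⟨0, (distR_spec ⟨x, hx⟩ x).1⟩
  rw [← sum_fillProb_avoid_singleton p b z, ← map_arc_compl X hx (z := z) rfl,
    sum_ballHolePairs_map]
  refine Finset.sum_congr rfl fun c hc => ?_
  rw [mem_ballHolePairs] at hc
  have := fillProb_map (avoidKernel (golfKernel p) {z}) (avoidKernel (golfKernel p) X) (arc X hx)
    {z}ᶜ ∅ (fun T v h => avoidKernel_arc p X hx rfl T v h) b c.1 c.2 hc.1 hc.2.1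
  rwa [Finset.map_empty] at this

/-- Balls and holes lying in different blocks of `X` do not interact as long as the holes of `X`
remain free. -/
theorem avoidKernel_local {ι : Type*} [DecidableEq ι] (p : ℝ) {X : Finset (Fin n)}
    (hX : X.Nonempty) (κ : Fin n → ι)
    (hκ : ∀ v w, κ v = κ w ↔ blockStart X v = blockStart X w) (T : Finset (Fin n))
    (v h : Fin n) :
    avoidKernel (golfKernel p) X T v h =
      if κ h = κ v then avoidKernel (golfKernel p) X (T.filter fun w => κ w = κ v) v h else 0 := by
  by_cases hvh : v ∈ X ∨ h ∈ X
  · simp [avoidKernel, hvh]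
  simp only [avoidKernel, if_neg hvh]
  push Not at hvh
  obtain ⟨hv, hhX⟩ := hvh
  obtain ⟨r1, r2, r3, r4⟩ := distR_spec hX v
  obtain ⟨l1, l2, l3, l4⟩ := distL_spec hX v
  have eR : distR (T ∪ X) v = distR (T.filter (fun w => κ w = κ v) ∪ X) v := by
    refine distR_congr r1 r2 (Finset.mem_union_right _ r3) fun d _ hd => ?_
    rcases hd.lt_or_eq with hlt | rfl
    · simp [hκ, blockStart_shiftR hX hlt hv]
    · exact iff_of_true (Finset.mem_union_right _ r3) (Finset.mem_union_right _ r3)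
  have eL : distL (T ∪ X) v = distL (T.filter (fun w => κ w = κ v) ∪ X) v := by
    refine distL_congr l1 l2 (Finset.mem_union_right _ l3) fun d _ hd => ?_
    rcases hd.lt_or_eq with hlt | rfl
    · simp [hκ, blockStart_shiftL hX hlt]
    · exact iff_of_true (Finset.mem_union_right _ l3) (Finset.mem_union_right _ l3)
  split_ifs with hc
  · rw [golfKernel, golfKernel, ← rightProb_congr p eR eL, ← eR, ← eL]
  · have leR : distR (T ∪ X) v ≤ distR X v := distR_le r1 (Finset.mem_union_right _ r3)
    have leL : distL (T ∪ X) v ≤ distL X v := distL_le l1 (Finset.mem_union_right _ l3)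
    rw [golfKernel, if_neg, if_neg, add_zero]
    · intro h1
      rcases leL.lt_or_eq with hlt | heq
      · exact hc ((hκ _ _).mpr (by rw [h1, blockStart_shiftL hX hlt]))
      · rw [heq] at h1
        exact hhX (h1 ▸ l3)
    · intro h1
      rcases leR.lt_or_eq with hlt | heq
      · exact hc ((hκ _ _).mpr (by rw [h1, blockStart_shiftR hX hlt hv]))
      · rw [heq] at h1
        exact hhX (h1 ▸ r3)

end Arc

/-- A sum over disjoint pairs of a product over colours is a sum over the numbers of balls of each
colour. -/
theorem sum_ballHolePairs_prod {V : Type*} [DecidableEq V] {K : ℕ} (D : Finset V) (m : ℕ)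
    (κ : V → Fin K) (F : Finset V → Finset V → ℝ) :
    ∑ c ∈ ballHolePairs D m,
        ∏ i, F (c.1.filter fun v => κ v = i) (c.2.filter fun v => κ v = i) =
      ∑ b ∈ Finset.Nat.antidiagonalTuple K m,
        ∏ i, ∑ c ∈ ballHolePairs (D.filter fun v => κ v = i) (b i), F c.1 c.2 := by
  rw [← Finset.sum_fiberwise_of_maps_to (t := Finset.Nat.antidiagonalTuple K m)
    (g := fun c => fun i => (c.1.filter fun v => κ v = i).card)]
  · refine Finset.sum_congr rfl fun b hb => ?_
    rw [Finset.Nat.mem_antidiagonalTuple] at hb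
    rw [Finset.prod_univ_sum]
    have hglue : ∀ (x : Fin K → Finset V), (∀ i, ∀ v ∈ x i, κ v = i) → ∀ i,
        (Finset.univ.biUnion x).filter (fun v => κ v = i) = x i := by
      intro x hx i
      ext v
      simp only [Finset.mem_filter, Finset.mem_biUnion, Finset.mem_univ, true_and]
      constructor
      · rintro ⟨⟨j, hj⟩, rfl⟩
        rwa [hx j v hj]
      · intro hv
        exact ⟨⟨i, hv⟩, hx i v hv⟩
    have hsplit : ∀ B : Finset V,
        (Finset.univ.biUnion fun i => B.filter fun v => κ v = i) = B := by
      intro B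
      ext v
      simp
    refine Finset.sum_nbij'
      (fun c i => (c.1.filter fun v => κ v = i, c.2.filter fun v => κ v = i))
      (fun x => (Finset.univ.biUnion fun i => (x i).1, Finset.univ.biUnion fun i => (x i).2))
      ?_ ?_ ?_ ?_ ?_
    · intro c hc
      simp only [Finset.mem_filter, mem_ballHolePairs] at hc
      rw [Fintype.mem_piFinset]
      intro i
      rw [mem_ballHolePairs]
      exact ⟨Finset.filter_subset_filter _ hc.1.1, Finset.filter_subset_filter _ hc.1.2.1,
        Finset.disjoint_filter_filter hc.1.2.2.1, congrFun hc.2 i⟩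
    · intro x hx
      rw [Fintype.mem_piFinset] at hx
      simp only [mem_ballHolePairs] at hx
      have h1 : ∀ i, ∀ v ∈ (x i).1, κ v = i := fun i v hv =>
        (Finset.mem_filter.mp ((hx i).1 hv)).2
      have h2 : ∀ i, ∀ v ∈ (x i).2, κ v = i := fun i v hv =>
        (Finset.mem_filter.mp ((hx i).2.1 hv)).2
      have hcard : ∀ i, ((Finset.univ.biUnion fun i => (x i).1).filter fun v => κ v = i).card =
          b i := fun i => by rw [hglue (fun i => (x i).1) h1, (hx i).2.2.2]
      simp only [Finset.mem_filter, mem_ballHolePairs]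
      refine ⟨⟨?_, ?_, ?_, ?_⟩, funext hcard⟩
      · exact Finset.biUnion_subset.mpr fun i _ => (hx i).1.trans (Finset.filter_subset _ _)
      · exact Finset.biUnion_subset.mpr fun i _ => (hx i).2.1.trans (Finset.filter_subset _ _)
      · rw [Finset.disjoint_left]
        intro v hv hv'
        obtain ⟨i, -, hi⟩ := Finset.mem_biUnion.mp hv
        obtain ⟨j, -, hj⟩ := Finset.mem_biUnion.mp hv'
        obtain rfl : i = j := (h1 i v hi).symm.trans (h2 j v hj)
        exact Finset.disjoint_left.mp (hx i).2.2.1 hi hj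
      · rw [Finset.card_eq_sum_card_fiberwise (f := κ) (t := Finset.univ) (by simp),
          Finset.sum_congr rfl fun i _ => hcard i, hb]
    · intro c _
      simp only [hsplit]
    · intro x hx
      rw [Fintype.mem_piFinset] at hx
      simp only [mem_ballHolePairs] at hx
      funext i
      refine Prod.ext ?_ ?_
      · exact hglue (fun i => (x i).1) (fun i v hv => (Finset.mem_filter.mp ((hx i).1 hv)).2) i
      · exact hglue (fun i => (x i).2) (fun i v hv => (Finset.mem_filter.mp ((hx i).2.1 hv)).2) i
    · intro c _
      rfl
  · intro c hc
    rw [mem_ballHolePairs] at hc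
    rw [Finset.Nat.mem_antidiagonalTuple, ← hc.2.2.2,
      ← Finset.card_eq_sum_card_fiberwise (f := κ) (t := Finset.univ) (by simp)]

section Positions

variable {n : ℕ}

/-- The vertex of the cycle at a given position. -/
def vertexAt (n : ℕ) (hn : 0 < n) (l : ℕ) : Fin n := ⟨l % n, Nat.mod_lt _ hn⟩

theorem shiftR_vertexAt (hn : 0 < n) (l d : ℕ) :
    shiftR (vertexAt n hn l) d = vertexAt n hn (l + d) := by
  apply Fin.ext
  simp [shiftR, vertexAt, Nat.mod_add_mod]

theorem cpos_vertexAt (hn : 0 < n) {l : ℕ} (h1 : 1 ≤ l) (h2 : l ≤ n) :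
    cpos (vertexAt n hn l) = l := by
  rcases h2.lt_or_eq with h | rfl
  · simp only [cpos, vertexAt, Nat.mod_eq_of_lt h]
    rw [if_neg (by omega)]
  · simp [cpos, vertexAt]

theorem vertexAt_cpos (hn : 0 < n) (v : Fin n) : vertexAt n hn (cpos v) = v := by
  apply Fin.ext
  simp only [cpos, vertexAt]
  split_ifs with h
  · rw [Nat.mod_self, h]
  · exact Nat.mod_eq_of_lt v.isLt

theorem cpos_bounds (v : Fin n) : 1 ≤ cpos v ∧ cpos v ≤ n := by
  have := v.isLt
  rw [cpos]
  split_ifs <;> omega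

theorem mem_sortedPos (hn : 0 < n) {X : Finset (Fin n)} {l : ℕ} :
    l ∈ sortedPos X ↔ 1 ≤ l ∧ l ≤ n ∧ vertexAt n hn l ∈ X := by
  simp only [sortedPos, Finset.mem_sort, Finset.mem_image]
  constructor
  · rintro ⟨v, hv, rfl⟩
    exact ⟨(cpos_bounds v).1, (cpos_bounds v).2, by rwa [vertexAt_cpos]⟩
  · rintro ⟨h1, h2, h3⟩
    exact ⟨_, h3, cpos_vertexAt hn h1 h2⟩

theorem length_sortedPos (hn : 0 < n) (X : Finset (Fin n)) : (sortedPos X).length = X.card := by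
  rw [sortedPos, Finset.length_sort, Finset.card_image_of_injective]
  exact Function.LeftInverse.injective (vertexAt_cpos hn)

/-- The elements of `X` can be enumerated in such a way that the arc starting at the `i`-th element
is the `i`-th block. -/
theorem exists_equiv_distR (hn : 0 < n) {K : ℕ} (X : Finset (Fin n)) (hX : X.card = K) :
    ∃ e : Fin K ≃ {x // x ∈ X}, ∀ i, distR X (e i).1 = blockSize X i.val + 1 := by
  subst hX
  have hlen := length_sortedPos hn X
  set q := sortedPos X with hq
  set K := X.card with hK
  have hmem : ∀ j, j < K → q.getD j 0 ∈ q := fun j hj => by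
    rw [List.getD_eq_getElem _ _ (hlen ▸ hj)]
    exact List.getElem_mem _
  have hlt : ∀ i j, i < j → j < K → q.getD i 0 < q.getD j 0 := fun i j hij hj => by
    rw [List.getD_eq_getElem q _ (hlen ▸ hj : j < q.length),
      List.getD_eq_getElem q _ (hlen ▸ hij.trans hj : i < q.length)]
    exact (Finset.sortedLT_sort _).getElem_lt_getElem_of_lt hij
  have hget : ∀ l ∈ q, ∃ j < K, q.getD j 0 = l := fun l hl => by
    obtain ⟨j, hj, rfl⟩ := List.getElem_of_mem hl
    exact ⟨j, hlen ▸ hj, List.getD_eq_getElem _ _ hj⟩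
  have hle : ∀ i j, i ≤ j → j < K → q.getD i 0 ≤ q.getD j 0 := fun i j hij hj => by
    rcases hij.lt_or_eq with h | rfl
    · exact (hlt i j h hj).le
    · rfl
  have hX' : ∀ j, j < K → 1 ≤ q.getD j 0 ∧ q.getD j 0 ≤ n ∧ vertexAt n hn (q.getD j 0) ∈ X :=
    fun j hj => (mem_sortedPos hn).mp (hmem j hj)
  have hinj : ∀ i j, i < K → j < K → q.getD i 0 = q.getD j 0 → i = j := by
    intro i j hi hj h
    rcases lt_trichotomy i j with h' | h' | h'
    · exact absurd h (hlt i j h' hj).ne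
    · exact h'
    · exact absurd h (hlt j i h' hi).ne'
  have hprev : ∀ i, i < K → (i + K - 1) % K = if i = 0 then K - 1 else i - 1 := by
    intro i hi
    split_ifs with h
    · rw [h, zero_add]
      exact Nat.mod_eq_of_lt (by omega)
    · rw [show i + K - 1 = i - 1 + K by omega, Nat.add_mod_right]
      exact Nat.mod_eq_of_lt (by omega)
  have hprev_lt : ∀ i, i < K → (i + K - 1) % K < K := fun i hi => Nat.mod_lt _ (by omega)
  let f : Fin K → {x // x ∈ X} := fun i =>
    ⟨vertexAt n hn (q.getD ((i.val + K - 1) % K) 0), (hX' _ (hprev_lt _ i.isLt)).2.2⟩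
  have hf : Function.Injective f := by
    intro i j h
    have h1 := congrArg cpos (congrArg Subtype.val h)
    have bi := hX' _ (hprev_lt _ i.isLt)
    have bj := hX' _ (hprev_lt _ j.isLt)
    simp only [f] at h1
    rw [cpos_vertexAt hn bi.1 bi.2.1, cpos_vertexAt hn bj.1 bj.2.1] at h1
    have h2 := hinj _ _ (hprev_lt _ i.isLt) (hprev_lt _ j.isLt) h1
    have hi := i.isLt
    have hj := j.isLt
    rw [hprev _ hi, hprev _ hj] at h2
    apply Fin.ext
    split_ifs at h2 <;> omega
  have hbij : Function.Bijective f :=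
    (Fintype.bijective_iff_injective_and_card f).mpr ⟨hf, by simp [hK]⟩
  refine ⟨Equiv.ofBijective f hbij, fun i => ?_⟩
  have hi := i.isLt
  simp only [Equiv.ofBijective_apply, f, blockSize, ← hq, hlen]
  rw [Nat.mod_eq_of_lt hi, hprev _ hi]
  split_ifs with h0
  · obtain ⟨a1, a2, a3⟩ := hX' 0 (by omega)
    obtain ⟨b1, b2, b3⟩ := hX' (K - 1) (by omega)
    have hle' := hle 0 (K - 1) (by omega) (by omega)
    rw [h0, Nat.mod_eq_of_lt (by omega)]
    refine distR_eq (by omega) (by omega) ?_ fun e he hlt' hmem' => ?_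
    · rw [shiftR_vertexAt]
      convert a3 using 1
      apply Fin.ext
      simp only [vertexAt]
      rw [show q.getD (K - 1) 0 + (q.getD 0 0 + n - q.getD (K - 1) 0 - 1 + 1) =
        q.getD 0 0 + n by omega, Nat.add_mod_right]
    · rw [shiftR_vertexAt] at hmem'
      rcases le_or_gt (q.getD (K - 1) 0 + e) n with hn' | hn'
      · obtain ⟨j, hj, hj'⟩ := hget _ ((mem_sortedPos hn).mpr ⟨by omega, hn', hmem'⟩)
        have := hle j (K - 1) (by omega) (by omega)
        omega
      · have hv : vertexAt n hn (q.getD (K - 1) 0 + e) =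
            vertexAt n hn (q.getD (K - 1) 0 + e - n) := by
          apply Fin.ext
          simp only [vertexAt]
          rw [← Nat.add_mod_right (q.getD (K - 1) 0 + e - n), Nat.sub_add_cancel hn'.le]
        rw [hv] at hmem'
        obtain ⟨j, hj, hj'⟩ := hget _ ((mem_sortedPos hn).mpr ⟨by omega, by omega, hmem'⟩)
        have := hle 0 j (by omega) hj
        omega
  · obtain ⟨a1, a2, a3⟩ := hX' i hi
    obtain ⟨b1, b2, b3⟩ := hX' (i - 1) (by omega)
    have hlt' := hlt (i - 1) i (by omega) hi
    rw [show q.getD i 0 + n - q.getD (i - 1) 0 - 1 = q.getD i 0 - q.getD (i - 1) 0 - 1 + n by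
      omega, Nat.add_mod_right, Nat.mod_eq_of_lt (by omega)]
    refine distR_eq (by omega) (by omega) ?_ fun e he hlt'' hmem' => ?_
    · rw [shiftR_vertexAt]
      rwa [show q.getD (i - 1) 0 + (q.getD i 0 - q.getD (i - 1) 0 - 1 + 1) = q.getD i 0 by omega]
    · rw [shiftR_vertexAt] at hmem'
      obtain ⟨j, hj, hj'⟩ := hget _ ((mem_sortedPos hn).mpr ⟨by omega, by omega, hmem'⟩)
      rcases le_or_gt j (i - 1) with h | h
      · have := hle j (i - 1) h (by omega)
        omega
      · have := hle i j (by omega) hj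
        omega

end Positions

/-- The number of golf configurations, up to the order of activation of the balls. -/
theorem card_golfInit_eq {n nb nt : ℕ} (h : nb + nt ≤ n) :
    ((golfInit n nb nt).card : ℝ) = nb.factorial * multinom3 nb nt (n - nb - nt) := by
  have h1 := Nat.factorial_mul_descFactorial (show nb ≤ n by omega)
  have h2 := Nat.choose_mul_factorial_mul_factorial (show nt ≤ n - nb by omega)
  have h3 : nb.factorial * multinom3 nb nt (n - nb - nt) = (golfInit n nb nt).card := by
    rw [card_golfInit, multinom3, show nb + nt + (n - nb - nt) = n by omega]
    have hpos : 0 < nb.factorial * nt.factorial * (n - nb - nt).factorial := by positivity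
    have hdvd : n.factorial = n.descFactorial nb * (n - nb).choose nt *
        (nt.factorial * (n - nb - nt).factorial) := by
      rw [← h1, ← h2]
      ring
    have hch : n.descFactorial nb = nb.factorial * n.choose nb :=
      Nat.descFactorial_eq_factorial_mul_choose n nb
    rw [hdvd, hch, show nb.factorial * n.choose nb * (n - nb).choose nt *
      (nt.factorial * (n - nb - nt).factorial) = n.choose nb * (n - nb).choose nt *
        (nb.factorial * nt.factorial * (n - nb - nt).factorial) by ring,
      Nat.mul_div_cancel _ hpos]
    ring
  rw [← h3]
  push_cast
  rfl

theorem golfProb_eq {n nb nt : ℕ} (hn : 1 ≤ n) (hnbt : nb + nt ≤ n) (hK : nb < nt) (p : ℝ)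
    (X : Finset (Fin n)) (hX : X.card = nt - nb) :
    golfProb n nb nt p X =
      (1 / (multinom3 nb nt (n - nb - nt) : ℝ)) *
        ∑ b ∈ (Finset.Nat.antidiagonalTuple (nt - nb) nb).filter
            (fun b => ∀ i, 2 * b i ≤ blockSize X i.val),
          ∏ i : Fin (nt - nb),
            (1 / ((b i : ℝ) + 1)) *
              (multinom3 (b i) (b i) (blockSize X i.val - 2 * b i) : ℝ) := by
  have hXne : X.Nonempty := Finset.card_pos.mp (by omega)
  obtain ⟨e, he⟩ := exists_equiv_distR hn X hX
  let κ : Fin n → Fin (nt - nb) := fun v => e.symm ⟨blockStart X v, blockStart_mem hXne v⟩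
  have hκ : ∀ v w, κ v = κ w ↔ blockStart X v = blockStart X w := fun v w => by simp [κ]
  have hblock : ∀ i, (Xᶜ.filter fun v => κ v = i) =
      Xᶜ.filter fun v => blockStart X v = (e i).1 := by
    intro i
    refine Finset.filter_congr fun v _ => ?_
    simp only [κ]
    rw [Equiv.symm_apply_eq, Subtype.ext_iff]
  have hsum : ∑ c ∈ (ballHolePairs Finset.univ nb).filter (fun c => c.2.card = nt),
      fillProb (golfKernel p) X nb c.1 c.2 =
      ∑ b ∈ (Finset.Nat.antidiagonalTuple (nt - nb) nb).filter
            (fun b => ∀ i, 2 * b i ≤ blockSize X i.val),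
          ∏ i : Fin (nt - nb),
            (1 / ((b i : ℝ) + 1)) *
              (multinom3 (b i) (b i) (blockSize X i.val - 2 * b i) : ℝ) := by
    have h1 := sum_fillProb_avoid (golfKernel p) X nb
    rw [show X.card + nb = nt by omega] at h1
    rw [h1]
    have h2 : ∀ c ∈ ballHolePairs Xᶜ nb,
        fillProb (avoidKernel (golfKernel p) X) ∅ nb c.1 c.2 =
          ∏ i, fillProb (avoidKernel (golfKernel p) X) ∅ (c.1.filter fun v => κ v = i).card
            (c.1.filter fun v => κ v = i) (c.2.filter fun v => κ v = i) := fun c hc =>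
      fillProb_eq_prod (avoidKernel (golfKernel p) X) κ
        (fun T v h _ => avoidKernel_local p hXne κ hκ T v h) nb c.1 c.2
        (mem_ballHolePairs.mp hc).2.2.2
    rw [Finset.sum_congr rfl h2, sum_ballHolePairs_prod Xᶜ nb κ fun B T =>
      fillProb (avoidKernel (golfKernel p) X) ∅ B.card B T, Finset.sum_filter]
    refine Finset.sum_congr rfl fun b _ => ?_
    have h3 : ∀ i, ∑ c ∈ ballHolePairs (Xᶜ.filter fun v => κ v = i) (b i),
        fillProb (avoidKernel (golfKernel p) X) ∅ c.1.card c.1 c.2 =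
        if 2 * b i ≤ blockSize X i.val then (1 / ((b i : ℝ) + 1)) *
          (multinom3 (b i) (b i) (blockSize X i.val - 2 * b i) : ℝ) else 0 := by
      intro i
      have h4 := sum_fillProb_block p X (e i).2 (b i)
      rw [he i, Nat.add_sub_cancel] at h4
      rw [← h4, hblock]
      refine Finset.sum_congr rfl fun c hc => ?_
      rw [(mem_ballHolePairs.mp hc).2.2.2]
    rw [Finset.prod_congr rfl fun i _ => h3 i]
    split_ifs with hb
    · exact Finset.prod_congr rfl fun i _ => if_pos (hb i)
    · push Not at hb
      obtain ⟨i, hi⟩ := hb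
      exact Finset.prod_eq_zero (Finset.mem_univ i) (if_neg (not_le.mpr hi))
  have hgolf : golfProb n nb nt p X =
      (∑ c ∈ golfInit n nb nt, orderedProb p X nb c.1 c.2) / (golfInit n nb nt).card := rfl
  have hfac : (nb.factorial : ℝ) ≠ 0 := by positivity
  rw [hgolf, sum_golfInit p X hK, hsum, card_golfInit_eq hnbt, mul_div_mul_left _ _ hfac,
    one_div, inv_mul_eq_div]

end Golf

open Golf

/-- **Distribution of the set of remaining holes in the golf model on `Z/nZ`**
(Theorem 1.4 of the paper).  If `K = nt - nb > 0`, then for every `X ⊆ Z/nZ` with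
`|X| = K`, writing `ℓ i = Δ_i X`,
`P(TL = X) = (1 / multinom(n; nb, nt, n-nb-nt)) ·
  Σ_{(b_i) : Σ b_i = nb, 2 b_i ≤ ℓ_i} Π_i (1/(b_i+1)) · multinom(ℓ_i; b_i, b_i, ℓ_i - 2 b_i)`;
in particular this probability does not depend on `p ∈ (0,1)`. -/
theorem golf_remaining_holes_law (n nb nt : ℕ) (hn : 1 ≤ n) (hnbt : nb + nt ≤ n)
    (hK : nb < nt) (p : ℝ) (hp0 : 0 < p) (hp1 : p < 1)
    (X : Finset (Fin n)) (hX : X.card = nt - nb) :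
    golfProb n nb nt p X =
      (1 / (multinom3 nb nt (n - nb - nt) : ℝ)) *
        ∑ b ∈ (Finset.Nat.antidiagonalTuple (nt - nb) nb).filter
            (fun b => ∀ i, 2 * b i ≤ blockSize X i.val),
          ∏ i : Fin (nt - nb),
            (1 / ((b i : ℝ) + 1)) *
              (multinom3 (b i) (b i) (blockSize X i.val - 2 * b i) : ℝ) ∧
    ∀ p' : ℝ, 0 < p' → p' < 1 → golfProb n nb nt p' X = golfProb n nb nt p X := by
  refine ⟨golfProb_eq hn hnbt hK p X hX, fun p' _ _ => ?_⟩
  rw [golfProb_eq hn hnbt hK p' X hX, golfProb_eq hn hnbt hK p X hX]
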